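/- arXiv:2604.10365 — 2 statements merged into one kernel-verified Lean document; each statement's English description precedes it below -/
import Mathlib

section
/- In the polynomial ring \mathbb{Z}[z_j : j \in \mathbb{Z}], define a_{0,j} = 1 and, for i \ge 1, let a_{i,j} be the determinant of the i×i tridiagonal matrix whose diagonal entries are z_j, z_{j+1}, \ldots, z_{j+i-1} and whose sub- and super-diagonal entries are all equal to 1. Then the family (a_{i,j}) is an infinite frieze with values in \mathbb{Z}[z_j : j \in \mathbb{Z}]; that is, a_{i,j}·a_{i,j+1} - a_{i-1,j+1}·a_{i+1,j} = 1 for all i \ge 1 and j \in \mathbb{Z}. (This is a consequence of the Desnanot–Jacobi identity.) -/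
open MvPolynomial

/-- The `i × i` tridiagonal matrix with diagonal entries `z_j, z_{j+1}, …, z_{j+i-1}`
and all sub- and super-diagonal entries equal to `1`, over `ℤ[z_j : j ∈ ℤ]`. -/
noncomputable def friezeMatrix (i : ℕ) (j : ℤ) :
    Matrix (Fin i) (Fin i) (MvPolynomial ℤ ℤ) :=
  Matrix.of fun k l =>
    if (k : ℕ) = (l : ℕ) then X (j + (k : ℕ))
    else if (k : ℕ) + 1 = (l : ℕ) ∨ (l : ℕ) + 1 = (k : ℕ) then 1 else 0

/-- The universal infinite frieze: `a i j` is the determinant of the `i × i`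
tridiagonal matrix above (so `a 0 j = 1`, the determinant of the empty matrix). -/
noncomputable def univA (i : ℕ) (j : ℤ) : MvPolynomial ℤ ℤ :=
  (friezeMatrix i j).det

theorem univA_zero (j : ℤ) : univA 0 j = 1 := by
  simp [univA]

theorem univA_one (j : ℤ) : univA 1 j = X j := by
  simp [univA, friezeMatrix]

theorem friezeMatrix_submatrix_succ (n : ℕ) (j : ℤ) :
    (friezeMatrix (n + 1) j).submatrix Fin.succ Fin.succ = friezeMatrix n (j + 1) := by
  ext1 k l
  have h : j + ((k : ℕ) + 1 : ℤ) = j + 1 + (k : ℕ) := by ring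
  simp [friezeMatrix, h]

/-- Expanding the first column of the minor obtained by deleting row `0` and column `1`. -/
theorem det_friezeMatrix_minor_zero_one (n : ℕ) (j : ℤ) :
    ((friezeMatrix (n + 2) j).submatrix Fin.succ (Fin.succAbove 1)).det = univA n (j + 2) := by
  have h : ((friezeMatrix (n + 2) j).submatrix Fin.succ (Fin.succAbove 1)).submatrix
      Fin.succ Fin.succ = friezeMatrix n (j + 2) := by
    have h2 : j + 2 = j + 1 + 1 := by ring
    rw [h2, ← friezeMatrix_submatrix_succ, ← friezeMatrix_submatrix_succ]
    ext1 k l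
    have hl : Fin.succAbove (1 : Fin (n + 2)) l.succ = l.succ.succ :=
      Fin.succAbove_of_lt_succ _ _ (by simp [Fin.lt_def])
    simp only [Matrix.submatrix_apply, hl]
  rw [Matrix.det_succ_column_zero, Fin.sum_univ_succ, Finset.sum_eq_zero]
  · simp only [Fin.succAbove_zero, h]
    simp [friezeMatrix, univA]
  · intro k _
    simp [friezeMatrix]

/-- The three-term recurrence (continuant recurrence) along the first row. -/
theorem univA_add_two (n : ℕ) (j : ℤ) :
    univA (n + 2) j = X j * univA (n + 1) (j + 1) - univA n (j + 2) := by
  rw [univA, Matrix.det_succ_row_zero, Fin.sum_univ_succ, Fin.sum_univ_succ,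
    Finset.sum_eq_zero]
  · simp only [Fin.succAbove_zero, friezeMatrix_submatrix_succ, Fin.succ_zero_eq_one,
      det_friezeMatrix_minor_zero_one]
    simp [friezeMatrix, univA, sub_eq_add_neg]
  · intro k _
    simp [friezeMatrix]

/-- The family `(univA i j)` is an infinite frieze with values in
`ℤ[z_j : j ∈ ℤ]`: it satisfies the unimodularity relation
`a i j * a i (j+1) - a (i-1) (j+1) * a (i+1) j = 1` for all `i ≥ 1`, `j ∈ ℤ`. -/
theorem universal_frieze_unimodularity :
    ∀ i : ℕ, 1 ≤ i → ∀ j : ℤ,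
      univA i j * univA i (j + 1) - univA (i - 1) (j + 1) * univA (i + 1) j = 1 := by
  intro i hi
  induction i, hi using Nat.le_induction with
  | base =>
    intro j
    simp only [Nat.sub_self, univA_add_two 0, univA_zero, univA_one, Nat.reduceAdd]
    ring
  | succ n hn ih =>
    intro j
    obtain ⟨m, rfl⟩ := Nat.exists_eq_add_of_le' hn
    have h := ih (j + 1)
    have h2 : j + 1 + 1 = j + 2 := by ring
    simp only [Nat.add_sub_cancel, h2] at h ⊢
    rw [univA_add_two m j, univA_add_two (m + 1) j]
    linear_combination h
end

section
/- Let R be an integral domain and let (a_{i,j}) be an r-periodic infinite frieze with values in R all of whose entries are non-zero. Define its growth coefficients by s_0 = 2 and s_k = a_{rk,j} - a_{rk-2,j+1} for k \ge 1 (independent of j). Then s_{k+2} = s_1·s_{k+1} - s_k for all k \ge 0. -/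
/-- The product `C (c (j + n - 1)) * ⋯ * C (c (j + 1)) * C (c j)` of the matrices
`C x = !![x, -1; 1, 0]`. -/
def friezeTransfer {R : Type*} [CommRing R] (c : ℤ → R) : ℕ → ℤ → Matrix (Fin 2) (Fin 2) R
  | 0, _ => 1
  | n + 1, j => !![c (j + n), -1; 1, 0] * friezeTransfer c n j

section Transfer

variable {R : Type*} [CommRing R] (c : ℤ → R)

theorem friezeTransfer_add (m n : ℕ) (j : ℤ) :
    friezeTransfer c (m + n) j = friezeTransfer c m (j + n) * friezeTransfer c n j := by
  induction m with
  | zero => simp [friezeTransfer]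
  | succ m ih =>
    have h : j + ((m + n : ℕ) : ℤ) = j + n + m := by push_cast; ring
    rw [show m + 1 + n = (m + n) + 1 by ring, friezeTransfer, friezeTransfer, ih, h,
      Matrix.mul_assoc]

theorem det_friezeTransfer (n : ℕ) (j : ℤ) : (friezeTransfer c n j).det = 1 := by
  induction n with
  | zero => simp [friezeTransfer]
  | succ n ih => rw [friezeTransfer, Matrix.det_mul, ih, Matrix.det_fin_two_of]; ring

theorem friezeTransfer_add_period {r : ℤ} (hc : ∀ j, c j = c (j + r)) (n : ℕ) (j : ℤ) :
    friezeTransfer c n (j + r) = friezeTransfer c n j := by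
  induction n with
  | zero => rfl
  | succ n ih => rw [friezeTransfer, friezeTransfer, ih, hc (j + n), add_right_comm]

theorem friezeTransfer_period_mul {r : ℕ} (hc : ∀ j, c j = c (j + r)) (k : ℕ) (j : ℤ) :
    friezeTransfer c (r * k) j = friezeTransfer c r j ^ k := by
  induction k with
  | zero => rfl
  | succ k ih =>
    rw [mul_add, mul_one, friezeTransfer_add, friezeTransfer_add_period c hc, ih, pow_succ]

theorem trace_pow_add_two_of_det_eq_one {A : Matrix (Fin 2) (Fin 2) R} (hA : A.det = 1) (k : ℕ) :
    (A ^ (k + 2)).trace = A.trace * (A ^ (k + 1)).trace - (A ^ k).trace := by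
  have hsq : A ^ 2 = A.trace • A - 1 := by
    rw [Matrix.det_fin_two] at hA
    ext i j
    fin_cases i <;> fin_cases j <;>
      simp [pow_two, Matrix.mul_apply, Matrix.trace_fin_two] <;>
      first | ring1 | linear_combination -hA
  rw [pow_add, hsq, mul_sub, mul_one, mul_smul_comm, ← pow_succ, Matrix.trace_sub,
    Matrix.trace_smul, smul_eq_mul]

end Transfer

section Frieze

variable {R : Type*} [CommRing R] {a : ℤ → ℤ → R}

/-- The rows of a frieze with non-zero entries satisfy a linear recurrence whose coefficients are
the entries of the first row. -/
theorem frieze_linear_recurrence [IsDomain R]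
    (h0 : ∀ j : ℤ, a 0 j = 1) (hneg : ∀ j : ℤ, a (-1) j = 0)
    (huni : ∀ i : ℤ, 1 ≤ i → ∀ j : ℤ,
      a i j * a i (j + 1) - a (i - 1) (j + 1) * a (i + 1) j = 1)
    (hnz : ∀ i : ℤ, 0 ≤ i → ∀ j : ℤ, a i j ≠ 0) (n : ℕ) (j : ℤ) :
    a (n + 1) j = a 1 (j + n) * a n j - a (n - 1) j := by
  induction n generalizing j with
  | zero => simp [h0, hneg]
  | succ n ih =>
    push_cast
    have h1 := huni (n + 1) (by omega) j
    have h2 : a n j * a n (j + 1) - a (n - 1) (j + 1) * a (n + 1) j = 1 := by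
      rcases Nat.eq_zero_or_pos n with rfl | hn
      · simp [h0, hneg]
      · exact huni n (by omega) j
    have h3 := ih (j + 1)
    rw [show (j + 1 + n : ℤ) = j + (n + 1) by ring] at h3
    rw [add_sub_cancel_right] at h1 ⊢
    apply mul_left_cancel₀ (hnz n (by omega) (j + 1))
    linear_combination h2 - h1 + a (n + 1) j * h3

theorem friezeTransfer_succ_eq
    (h0 : ∀ j : ℤ, a 0 j = 1) (hneg : ∀ j : ℤ, a (-1) j = 0)
    (hrec : ∀ (n : ℕ) (j : ℤ), a (n + 1) j = a 1 (j + n) * a n j - a (n - 1) j)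
    (n : ℕ) (j : ℤ) :
    friezeTransfer (a 1) (n + 1) j =
      !![a (n + 1) j, -a n (j + 1); a n j, -a (n - 1) (j + 1)] := by
  induction n with
  | zero => simp [friezeTransfer, h0, hneg]
  | succ n ih =>
    have h1 := hrec (n + 1) j
    have h2 := hrec n (j + 1)
    rw [show (j + 1 + n : ℤ) = j + (n + 1) by ring] at h2
    push_cast at h1
    rw [add_sub_cancel_right] at h1
    rw [friezeTransfer, ih]
    push_cast
    rw [add_sub_cancel_right, h1, h2]
    ext x y
    fin_cases x <;> fin_cases y <;> simp [Matrix.mul_apply] <;> ring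

end Frieze

/-- Let `R` be an integral domain and `(a i j)` an `r`-periodic
infinite frieze with values in `R` all of whose entries are non-zero (conventions
`a 0 j = 1`, `a (-1) j = 0`), with growth coefficients `s 0 = 2` and
`s k = a (r*k) j - a (r*k - 2) (j+1)` for `k ≥ 1` (independent of `j`).
Then `s (k+2) = s 1 * s (k+1) - s k` for all `k ≥ 0`. -/
theorem domain_frieze_growth_coefficients_chebyshev
    {R : Type*} [CommRing R] [IsDomain R]
    (r : ℤ) (hr : 1 ≤ r) (a : ℤ → ℤ → R)
    (h0 : ∀ j : ℤ, a 0 j = 1)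
    (hneg : ∀ j : ℤ, a (-1) j = 0)
    (huni : ∀ i : ℤ, 1 ≤ i → ∀ j : ℤ,
      a i j * a i (j + 1) - a (i - 1) (j + 1) * a (i + 1) j = 1)
    (hnz : ∀ i : ℤ, 0 ≤ i → ∀ j : ℤ, a i j ≠ 0)
    (hper : ∀ i j : ℤ, a i j = a i (j + r))
    (s : ℕ → R)
    (hs0 : s 0 = 2)
    (hs : ∀ k : ℕ, 1 ≤ k → ∀ j : ℤ,
      s k = a (r * k) j - a (r * k - 2) (j + 1)) :
    ∀ k : ℕ, s (k + 2) = s 1 * s (k + 1) - s k := by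
  lift r to ℕ using by omega
  have hrec := frieze_linear_recurrence h0 hneg huni hnz
  have key : ∀ k : ℕ, s k = (friezeTransfer (a 1) r 0 ^ k).trace := by
    intro k
    rcases Nat.eq_zero_or_pos k with rfl | hk
    · simp [hs0]
    · rw [← friezeTransfer_period_mul _ (hper 1), hs k hk 0]
      obtain ⟨n, hn⟩ : ∃ n, r * k = n + 1 :=
        Nat.exists_eq_succ_of_ne_zero (Nat.mul_pos (by omega) hk).ne'
      have hn' : (r * k : ℤ) = n + 1 := by exact_mod_cast hn
      rw [hn, hn', friezeTransfer_succ_eq h0 hneg hrec, Matrix.trace_fin_two_of,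
        show (n + 1 - 2 : ℤ) = n - 1 by ring, sub_eq_add_neg]
  intro k
  rw [key, key, key, key, pow_one]
  exact trace_pow_add_two_of_det_eq_one (det_friezeTransfer _ _ _) k
end
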